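/- Let P^•, Q^• be almost-transverse complete flags in H, with t ∈ {1,…,d−1} the unique index such that dim_k(P^t ∩ Q^{t'}) = 1, where t' := d − t. Let a_•, b_• be strictly increasing sequences as in the context, and let Λ ∈ Σ°_{P^•,a_•} ∩ Σ°_{Q^•,b_•}. If t = a_i for some index i active in a_•, and t' = b_{i'} for some index i' active in b_•, and P^t ∩ Q^{t'} ⊆ Λ ⊆ P^t + Q^{t'}, then dim_k T(Λ) = E + 1. If these conditions do not all hold, then dim_k T(Λ) = E. -/

import Mathlib

open Module Submodule

section Defs

variable (k : Type*) [Field k] {H : Type*} [AddCommGroup H] [Module k H]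

/-- A complete flag in `H`, indexed by codimension: `P 0 = H ⊇ P 1 ⊇ ⋯ ⊇ P d = 0`
with `dim (P i) = d - i`. -/
def IsCompleteFlag (d : ℕ) (P : ℕ → Submodule k H) : Prop :=
  (∀ i ≤ d, Module.finrank k ↥(P i) = d - i) ∧ ∀ i < d, P (i + 1) ≤ P i

/-- `e` is a `(P,Q)`-basis with associated permutation `τ` (0-indexed: the basis vector
`e ℓ` corresponds to `e_{ℓ+1}` of the paper, and `(τ ℓ).val + 1` to `τ(ℓ+1)`):
`e ℓ ∈ P^ℓ ∖ P^{ℓ+1}` and `e ℓ ∈ Q^{τ ℓ} ∖ Q^{τ ℓ + 1}`. -/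
def IsFlagPermBasis (d : ℕ) (P Q : ℕ → Submodule k H)
    (τ : Equiv.Perm (Fin d)) (e : Fin d → H) : Prop :=
  LinearIndependent k e ∧ Submodule.span k (Set.range e) = ⊤ ∧
  (∀ ℓ : Fin d, e ℓ ∈ P ℓ.val ∧ e ℓ ∉ P (ℓ.val + 1)) ∧
  (∀ ℓ : Fin d, e ℓ ∈ Q (τ ℓ).val ∧ e ℓ ∉ Q ((τ ℓ).val + 1))

/-- Complete flags `P`, `Q` are transverse: `P^i ∩ Q^{d-i} = 0` for `0 < i < d`. -/
def FlagsTransverse (d : ℕ) (P Q : ℕ → Submodule k H) : Prop :=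
  ∀ i, 0 < i → i < d → P i ⊓ Q (d - i) = ⊥

/-- Complete flags `P`, `Q` are almost-transverse. -/
def FlagsAlmostTransverse (d : ℕ) (P Q : ℕ → Submodule k H) : Prop :=
  ∃ t, 1 ≤ t ∧ t < d ∧ Module.finrank k ↥(P t ⊓ Q (d - t)) = 1 ∧
    ∀ i, 1 ≤ i → i < d → i ≠ t → Module.finrank k ↥(P i ⊓ Q (d - i)) = 0

/-- The index `i` is active in the sequence `a`. -/
def ActiveIdx (a : ℕ → ℕ) (i : ℕ) : Prop :=
  (i = 0 ∧ 0 < a 0) ∨ (0 < i ∧ a (i - 1) + 1 < a i)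

/-- `Λ` lies in the Schubert variety `Σ_{P,a}` (for `Λ` of dimension `r+1`). -/
def MemSchubert (r : ℕ) (P : ℕ → Submodule k H) (a : ℕ → ℕ) (Λ : Submodule k H) : Prop :=
  ∀ i ≤ r, r + 1 - i ≤ Module.finrank k ↥(Λ ⊓ P (a i))

/-- `Λ` lies in the open subset `Σ°_{P,a}` of the Schubert variety. -/
def MemSchubertOpen (r : ℕ) (P : ℕ → Submodule k H) (a : ℕ → ℕ) (Λ : Submodule k H) : Prop :=
  MemSchubert k r P a Λ ∧
    ∀ i ≤ r, ActiveIdx a i → Module.finrank k ↥(Λ ⊓ P (a i)) = r + 1 - i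

/-- `lam` is an adapted basis of `Λ` for the flags `Λ ∩ P^•` and `Λ ∩ Q^•`, with associated
permutation `σ`: `lam j` lies in the codimension-`j` member of the flag `Λ ∩ P^•` but not in
the codimension-`(j+1)` member (membership in a member of the flag `Λ ∩ P^•` being equivalent
to that member having dimension at least `r + 1 - j`), and likewise for `Λ ∩ Q^•` with `σ j`
in place of `j`. -/
def IsAdaptedBasis (d r : ℕ) (P Q : ℕ → Submodule k H) (Λ : Submodule k H)
    (σ : Equiv.Perm (Fin (r + 1))) (lam : Fin (r + 1) → H) : Prop :=
  LinearIndependent k lam ∧ Submodule.span k (Set.range lam) = Λ ∧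
  (∀ j : Fin (r + 1), ∀ i ≤ d,
    (lam j ∈ Λ ⊓ P i ↔ r + 1 - j.val ≤ Module.finrank k ↥(Λ ⊓ P i))) ∧
  (∀ j : Fin (r + 1), ∀ i ≤ d,
    (lam j ∈ Λ ⊓ Q i ↔ r + 1 - (σ j).val ≤ Module.finrank k ↥(Λ ⊓ Q i)))

/-- The subspace of `Hom(Λ, H/Λ)` of maps `φ` with `φ(Λ ∩ P^{a i}) ⊆ (P^{a i} + Λ)/Λ`
for all `i ∈ S`. -/
def schubertTangent (P : ℕ → Submodule k H) (a : ℕ → ℕ) (Λ : Submodule k H) (S : Set ℕ) :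
    Submodule k (↥Λ →ₗ[k] H ⧸ Λ) :=
  ⨅ i ∈ S, Submodule.compatibleMaps
    (Submodule.comap Λ.subtype (P (a i))) (Submodule.map Λ.mkQ (P (a i)))

/-- The tangent-space model `T(Λ)` at `Λ ∈ Σ°_{P,a} ∩ Σ°_{Q,b}`: all `φ : Λ → H/Λ` with
`φ(Λ ∩ P^{a i}) ⊆ (P^{a i} + Λ)/Λ` for every `i` active in `a` and
`φ(Λ ∩ Q^{b i}) ⊆ (Q^{b i} + Λ)/Λ` for every `i` active in `b`. -/
def pairTangent (r : ℕ) (P Q : ℕ → Submodule k H) (a b : ℕ → ℕ) (Λ : Submodule k H) :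
    Submodule k (↥Λ →ₗ[k] H ⧸ Λ) :=
  schubertTangent k P a Λ {i | i ≤ r ∧ ActiveIdx a i} ⊓
    schubertTangent k Q b Λ {i | i ≤ r ∧ ActiveIdx b i}

/-- The number of inversions of a permutation of `Fin d`. -/
def invCount {d : ℕ} (τ : Equiv.Perm (Fin d)) : ℕ :=
  ((Finset.univ : Finset (Fin d × Fin d)).filter fun p => p.1 < p.2 ∧ τ p.2 < τ p.1).card

end Defs

section DimensionOfSchubertTangent

variable {k : Type*} [Field k] {H : Type*} [AddCommGroup H] [Module k H]

/-- Subspaces `D 0, …, D (n - 1)` with `dim (D j) ≥ n - j` contain linearly independent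
representatives. -/
lemma exists_linearIndependent_mem_of_le_finrank {V : Type*} [AddCommGroup V] [Module k V]
    [FiniteDimensional k V]
    (n : ℕ) (D : ℕ → Submodule k V) (hD : ∀ j < n, n - j ≤ finrank k (D j)) :
    ∃ v : Fin n → V, LinearIndependent k v ∧ ∀ j : Fin n, v j ∈ D j := by
  induction n generalizing D with
  | zero => exact ⟨Fin.elim0, linearIndependent_empty_type, fun j => j.elim0⟩
  | succ n ih =>
    obtain ⟨v, hv, hvD⟩ := ih (fun j => D (j + 1)) fun j hj => by
      have := hD (j + 1) (by omega)
      omega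
    have hnle : ¬ D 0 ≤ span k (Set.range v) := fun hle => by
      have h1 := Submodule.finrank_mono hle
      have h2 := finrank_span_eq_card hv
      have h3 := hD 0 (by omega)
      simp only [Fintype.card_fin] at h2
      omega
    obtain ⟨x, hxD, hx⟩ := SetLike.not_le_iff_exists.1 hnle
    refine ⟨Fin.cons x v, linearIndependent_finCons.2 ⟨hv, hx⟩, fun j => ?_⟩
    refine Fin.cases ?_ (fun j => ?_) j
    · simpa using hxD
    · simpa using hvD j

lemma mem_schubertTangent {P : ℕ → Submodule k H} {a : ℕ → ℕ} {Λ : Submodule k H} {S : Set ℕ}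
    {φ : ↥Λ →ₗ[k] H ⧸ Λ} :
    φ ∈ schubertTangent k P a Λ S ↔
      ∀ i ∈ S, ∀ x : Λ, (x : H) ∈ P (a i) → φ x ∈ (P (a i)).map Λ.mkQ := by
  simp only [schubertTangent, Submodule.mem_iInf]
  rfl

lemma IsCompleteFlag.antitone {d : ℕ} {P : ℕ → Submodule k H} (hP : IsCompleteFlag k d P)
    {m n : ℕ} (hmn : m ≤ n) (hn : n ≤ d) : P n ≤ P m := by
  induction n, hmn using Nat.le_induction with
  | base => exact le_rfl
  | succ n hmn ih => exact (hP.2 n (by omega)).trans (ih (by omega))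

lemma IsCompleteFlag.eq_bot {d : ℕ} [FiniteDimensional k H] {P : ℕ → Submodule k H}
    (hP : IsCompleteFlag k d P) : P d = ⊥ := by
  have := hP.1 d le_rfl
  rw [Nat.sub_self] at this
  exact Submodule.finrank_eq_zero.1 this

lemma le_of_strictMono_below {r : ℕ} {a : ℕ → ℕ} (ha : ∀ i < r, a i < a (i + 1)) {i j : ℕ}
    (hij : i ≤ j) (hj : j ≤ r) : a i ≤ a j := by
  induction j, hij using Nat.le_induction with
  | base => exact le_rfl
  | succ n hmn ih => exact (ih (by omega)).trans (ha n (by omega)).le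

/-- The codimension in `H ⧸ Λ` of the image of a subspace. -/
lemma finrank_quotient_map_mkQ [FiniteDimensional k H] (Λ W : Submodule k H) :
    (finrank k ((H ⧸ Λ) ⧸ W.map Λ.mkQ) : ℤ) =
      finrank k H - finrank k Λ - finrank k W + finrank k ↥(Λ ⊓ W) := by
  have h1 := (Submodule.quotientQuotientEquivQuotientSup Λ W).finrank_eq
  have h2 := Submodule.finrank_quotient_add_finrank (Λ ⊔ W)
  have h3 := Submodule.finrank_sup_add_finrank_inf_eq Λ W
  omega

/-- The intersection of the images in `H ⧸ Λ` of the `P (a i)`, for active `i ≤ j`, has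
codimension `a j - j`. -/
lemma finrank_quotient_iInf_map [FiniteDimensional k H] {d r : ℕ} (hH : finrank k H = d)
    {P : ℕ → Submodule k H} (hP : IsCompleteFlag k d P) {a : ℕ → ℕ}
    (ha : ∀ i < r, a i < a (i + 1)) (had : a r < d) {Λ : Submodule k H}
    (hΛ : finrank k Λ = r + 1) (hΛa : MemSchubertOpen k r P a Λ) (j : ℕ) (hj : j ≤ r) :
    (finrank k ((H ⧸ Λ) ⧸ ⨅ i ∈ {i | i ≤ j ∧ ActiveIdx a i}, (P (a i)).map Λ.mkQ) : ℤ) =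
      a j - j := by
  have hle : a j ≤ a r := le_of_strictMono_below ha hj le_rfl
  by_cases hact : ActiveIdx a j
  · have heq : ⨅ i ∈ {i | i ≤ j ∧ ActiveIdx a i}, (P (a i)).map Λ.mkQ
        = (P (a j)).map Λ.mkQ := by
      apply le_antisymm
      · exact iInf₂_le j ⟨le_rfl, hact⟩
      · refine le_iInf₂ fun i hi => Submodule.map_mono ?_
        exact hP.antitone (le_of_strictMono_below ha hi.1 hj) (by omega)
    have h1 := hΛa.2 j hj hact
    have h2 := hP.1 (a j) (by omega)
    rw [heq, finrank_quotient_map_mkQ]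
    omega
  · induction j with
    | zero =>
      have h0 : a 0 = 0 := by
        by_contra h
        exact hact (Or.inl ⟨rfl, by omega⟩)
      have heq : ⨅ i ∈ {i | i ≤ 0 ∧ ActiveIdx a i}, (P (a i)).map Λ.mkQ = ⊤ := by
        refine iInf₂_eq_top.2 fun i hi => absurd hi.2 ?_
        rwa [Nat.le_zero.1 hi.1]
      rw [heq, finrank_eq_zero_of_subsingleton, h0]
      rfl
    | succ j ih =>
      have hstep : a (j + 1) = a j + 1 := by
        have := ha j (by omega)
        by_contra h
        exact hact (Or.inr ⟨by omega, by simp only [Nat.add_sub_cancel]; omega⟩)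
      have hset : {i | i ≤ j + 1 ∧ ActiveIdx a i} = {i | i ≤ j ∧ ActiveIdx a i} := by
        ext i
        refine ⟨fun hi => ⟨?_, hi.2⟩, fun hi => ⟨hi.1.trans (by omega), hi.2⟩⟩
        rcases Nat.lt_or_ge j i with h | h
        · have : i = j + 1 := le_antisymm hi.1 h
          exact absurd (this ▸ hi.2) hact
        · exact h
      rw [hset, hstep]
      by_cases hact' : ActiveIdx a j
      · have heq : ⨅ i ∈ {i | i ≤ j ∧ ActiveIdx a i}, (P (a i)).map Λ.mkQ
            = (P (a j)).map Λ.mkQ := by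
          apply le_antisymm
          · exact iInf₂_le j ⟨le_rfl, hact'⟩
          · refine le_iInf₂ fun i hi => Submodule.map_mono ?_
            exact hP.antitone (le_of_strictMono_below ha hi.1 (by omega)) (by omega)
        have h1 := hΛa.2 j (by omega) hact'
        have h2 := hP.1 (a j) (by omega)
        rw [heq, finrank_quotient_map_mkQ]
        push_cast
        omega
      · rw [ih (by omega) (by omega) hact']
        push_cast
        ring

/-- The vector space `schubertTangent` has the expected codimension. -/
lemma finrank_schubertTangent [FiniteDimensional k H] {d r : ℕ} (hH : finrank k H = d)
    {P : ℕ → Submodule k H} (hP : IsCompleteFlag k d P) {a : ℕ → ℕ}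
    (ha : ∀ i < r, a i < a (i + 1)) (had : a r < d) {Λ : Submodule k H}
    (hΛ : finrank k Λ = r + 1) (hΛa : MemSchubertOpen k r P a Λ) :
    (finrank k (schubertTangent k P a Λ {i | i ≤ r ∧ ActiveIdx a i}) : ℤ) =
      finrank k (↥Λ →ₗ[k] H ⧸ Λ) - ∑ i ∈ Finset.range (r + 1), ((a i : ℤ) - i) := by
  have hcomap (i : ℕ) : finrank k (comap Λ.subtype (P (a i))) = finrank k ↥(Λ ⊓ P (a i)) := by
    rw [← Submodule.map_comap_subtype, Submodule.finrank_map_subtype_eq]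
  obtain ⟨v, hv, hvD⟩ := exists_linearIndependent_mem_of_le_finrank (r + 1)
    (fun j => ⨅ i ∈ {i | i ≤ j ∧ ActiveIdx a i}, comap Λ.subtype (P (a i))) fun j hj => by
      by_cases hne : ∃ i, i ≤ j ∧ ActiveIdx a i
      · classical
        have hmem : Nat.findGreatest (ActiveIdx a) j ≤ j ∧
            ActiveIdx a (Nat.findGreatest (ActiveIdx a) j) :=
          ⟨Nat.findGreatest_le j,
            Nat.findGreatest_spec hne.choose_spec.1 hne.choose_spec.2⟩
        set m := Nat.findGreatest (ActiveIdx a) j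
        have hle : comap Λ.subtype (P (a m)) ≤
            ⨅ i ∈ {i | i ≤ j ∧ ActiveIdx a i}, comap Λ.subtype (P (a i)) := by
          refine le_iInf₂ fun i hi => Submodule.comap_mono ?_
          refine hP.antitone (le_of_strictMono_below ha
            (Nat.le_findGreatest hi.1 hi.2) (by omega)) ?_
          have := le_of_strictMono_below ha (show m ≤ r by omega) le_rfl
          omega
        have h1 := Submodule.finrank_mono hle
        have h2 := hΛa.2 m (by omega) hmem.2
        rw [hcomap] at h1
        omega
      · have heq : ⨅ i ∈ {i | i ≤ j ∧ ActiveIdx a i}, comap Λ.subtype (P (a i)) = ⊤ :=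
          iInf₂_eq_top.2 fun i hi => absurd ⟨i, hi⟩ hne
        rw [heq, finrank_top]
        omega
  replace hvD (j : Fin (r + 1)) (i : ℕ) (hij : i ≤ j) (hi : ActiveIdx a i) :
      (v j : H) ∈ P (a i) := by
    have := hvD j
    simp only [Submodule.mem_iInf] at this
    exact this i ⟨hij, hi⟩
  let B := basisOfLinearIndependentOfCardEqFinrank hv (by simp [hΛ])
  have hB : ⇑B = v := coe_basisOfLinearIndependentOfCardEqFinrank hv _
  let C (j : Fin (r + 1)) : Submodule k (H ⧸ Λ) :=
    ⨅ i ∈ {i | i ≤ (j : ℕ) ∧ ActiveIdx a i}, (P (a i)).map Λ.mkQ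
  have hspan (i : ℕ) (hir : i ≤ r) (hi : ActiveIdx a i) :
      span k (Set.range fun j : {j : Fin (r + 1) // i ≤ (j : ℕ)} => v j) =
        comap Λ.subtype (P (a i)) := by
    apply Submodule.eq_of_le_of_finrank_le
    · rw [Submodule.span_le]
      rintro _ ⟨j, rfl⟩
      exact hvD j i j.2 hi
    · have hli := hv.comp (fun j : {j : Fin (r + 1) // i ≤ (j : ℕ)} => (j : Fin (r + 1)))
        Subtype.val_injective
      rw [hcomap, hΛa.2 i hir hi]
      have := finrank_span_eq_card hli
      simp only [Function.comp_def] at this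
      rw [this, Fintype.card_subtype]
      have hIci : (Finset.univ.filter fun j : Fin (r + 1) => i ≤ (j : ℕ)) =
          Finset.Ici (⟨i, by omega⟩ : Fin (r + 1)) := by
        ext j
        simp [Fin.le_def]
      rw [hIci, Fin.card_Ici]
  have hmap : schubertTangent k P a Λ {i | i ≤ r ∧ ActiveIdx a i} =
      (Submodule.pi Set.univ C).map (B.constr k).toLinearMap := by
    ext φ
    rw [Submodule.mem_map_equiv, mem_schubertTangent]
    simp only [Submodule.mem_pi, Set.mem_univ, true_imp_iff, Module.Basis.constr_symm_apply, hB, C,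
      Submodule.mem_iInf]
    constructor
    · rintro h j i ⟨hij, hi⟩
      exact h i ⟨by omega, hi⟩ _ (hvD j i hij hi)
    · rintro h i ⟨hir, hi⟩ x hx
      have hx' : x ∈ comap Λ.subtype (P (a i)) := hx
      rw [← hspan i hir hi] at hx'
      have hle : span k (Set.range fun j : {j : Fin (r + 1) // i ≤ (j : ℕ)} => v j) ≤
          comap φ ((P (a i)).map Λ.mkQ) := by
        rw [Submodule.span_le]
        rintro _ ⟨j, rfl⟩
        exact h j i ⟨j.2, hi⟩
      exact hle hx'
  have hquot := (Submodule.quotientPi C).finrank_eq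
  rw [Module.finrank_pi_fintype] at hquot
  have hadd := Submodule.finrank_quotient_add_finrank (Submodule.pi Set.univ C)
  have hW : finrank k (Fin (r + 1) → H ⧸ Λ) = finrank k (↥Λ →ₗ[k] H ⧸ Λ) :=
    (B.constr k).finrank_eq
  have hsum : ((∑ j, finrank k ((H ⧸ Λ) ⧸ C j) : ℕ) : ℤ) =
      ∑ i ∈ Finset.range (r + 1), ((a i : ℤ) - i) := by
    rw [Finset.sum_range, Nat.cast_sum]
    exact Finset.sum_congr rfl fun j _ =>
      finrank_quotient_iInf_map hH hP ha had hΛ hΛa j (by omega)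
  rw [hmap, LinearEquiv.finrank_map_eq (B.constr k), ← hsum]
  omega

end DimensionOfSchubertTangent

section RankOneMaps

variable {k : Type*} [Field k] {H : Type*} [AddCommGroup H] [Module k H]

/-- The map `Λ → H ⧸ Λ`, `x ↦ ξ x • [h]`, bilinear in `ξ` and `h`. -/
def quotRankOne (Λ : Submodule k H) : Dual k H →ₗ[k] H →ₗ[k] (↥Λ →ₗ[k] H ⧸ Λ) :=
  LinearMap.mk₂ k (fun ξ h => (ξ ∘ₗ Λ.subtype).smulRight (Λ.mkQ h))
    (fun ξ ξ' h => by ext x; simp [add_smul])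
    (fun c ξ h => by ext x; simp [mul_smul])
    (fun ξ h h' => by ext x; simp)
    (fun c ξ h => by ext x; simp [smul_smul, mul_comm])

lemma quotRankOne_apply (Λ : Submodule k H) (ξ : Dual k H) (h : H) (x : Λ) :
    quotRankOne Λ ξ h x = ξ x • Λ.mkQ h := rfl

lemma quotRankOne_eq_zero_of_mem {Λ : Submodule k H} (ξ : Dual k H) {h : H} (hh : h ∈ Λ) :
    quotRankOne Λ ξ h = 0 := by
  ext x
  rw [quotRankOne_apply, Submodule.mkQ_apply, (Submodule.Quotient.mk_eq_zero Λ).2 hh, smul_zero,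
    LinearMap.zero_apply]

lemma quotRankOne_eq_zero_of_le_ker {Λ : Submodule k H} {ξ : Dual k H} (hξ : Λ ≤ LinearMap.ker ξ)
    (h : H) : quotRankOne Λ ξ h = 0 := by
  ext x
  rw [quotRankOne_apply, LinearMap.mem_ker.1 (hξ x.2), zero_smul, LinearMap.zero_apply]

lemma eq_top_of_quotRankOne_mem [FiniteDimensional k H] {Λ : Submodule k H}
    {S : Submodule k (↥Λ →ₗ[k] H ⧸ Λ)} (hS : ∀ ξ h, quotRankOne Λ ξ h ∈ S) : S = ⊤ := by
  refine Submodule.eq_top_iff'.2 fun φ => ?_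
  let B := Module.finBasis k Λ
  choose ξ hξ using fun j => (B.coord j).exists_extend
  choose h hh using fun j => Λ.mkQ_surjective (φ (B j))
  have hφ : φ = ∑ j, quotRankOne Λ (ξ j) (h j) := by
    ext x
    conv_lhs => rw [← B.sum_repr x]
    simp only [map_sum, map_smul, LinearMap.sum_apply, quotRankOne_apply, hh]
    refine Finset.sum_congr rfl fun j _ => ?_
    have := LinearMap.congr_fun (hξ j) x
    simp only [LinearMap.comp_apply, Submodule.subtype_apply, Module.Basis.coord_apply] at this
    rw [this]
  rw [hφ]
  exact Submodule.sum_mem _ fun j _ => hS _ _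

lemma quotRankOne_mem_schubertTangent {d : ℕ} {P : ℕ → Submodule k H}
    (hP : IsCompleteFlag k d P) {a : ℕ → ℕ} {Λ : Submodule k H} {S : Set ℕ} {m n : ℕ}
    (hm : m ≤ d) (hS : ∀ i ∈ S, a i ≤ m ∨ n ≤ a i) (had : ∀ i ∈ S, a i ≤ d)
    {ξ : Dual k H} (hξ : ξ ∈ (P n).dualAnnihilator) {h : H} (hh : h ∈ P m) :
    quotRankOne Λ ξ h ∈ schubertTangent k P a Λ S := by
  refine mem_schubertTangent.2 fun i hi x hx => ?_
  rw [quotRankOne_apply]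
  rcases hS i hi with him | hni
  · exact Submodule.smul_mem _ _ (Submodule.mem_map_of_mem (hP.antitone him hm hh))
  · rw [(Submodule.mem_dualAnnihilator ξ).1 hξ x (hP.antitone hni (had i hi) hx), zero_smul]
    exact Submodule.zero_mem _

/-- `S` contains all rank-one maps that raise the index of the flag `P`. -/
def ContainsRaising (d : ℕ) (P : ℕ → Submodule k H) (Λ : Submodule k H)
    (S : Submodule k (↥Λ →ₗ[k] H ⧸ Λ)) : Prop :=
  ∀ m < d, ∀ ξ ∈ (P (m + 1)).dualAnnihilator, ∀ h ∈ P m, quotRankOne Λ ξ h ∈ S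

lemma containsRaising_of_schubertTangent_le {d r : ℕ} {P : ℕ → Submodule k H}
    (hP : IsCompleteFlag k d P) {a : ℕ → ℕ} (ha : ∀ i < r, a i < a (i + 1)) (had : a r < d)
    {Λ : Submodule k H} {S : Submodule k (↥Λ →ₗ[k] H ⧸ Λ)}
    (hS : schubertTangent k P a Λ {i | i ≤ r ∧ ActiveIdx a i} ≤ S) :
    ContainsRaising d P Λ S := fun m hm _ hξ _ hh =>
  hS (quotRankOne_mem_schubertTangent hP hm.le (fun i _ => by omega)
    (fun i hi => (le_of_strictMono_below ha hi.1 le_rfl).trans had.le) hξ hh)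

lemma ContainsRaising.quotRankOne_mem [FiniteDimensional k H] {d : ℕ} {P Q : ℕ → Submodule k H}
    {Λ : Submodule k H} {S : Submodule k (↥Λ →ₗ[k] H ⧸ Λ)}
    (hSP : ContainsRaising d P Λ S) (hSQ : ContainsRaising d Q Λ S) {m n : ℕ}
    (hm : m < d) (hn : n < d) {h : H} (hhP : h ∈ P m) (hhQ : h ∈ Q n) {ξ : Dual k H}
    (hξ : ξ ∈ (P (m + 1) ⊓ Q (n + 1)).dualAnnihilator) : quotRankOne Λ ξ h ∈ S := by
  rw [Subspace.dualAnnihilator_inf_eq] at hξ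
  obtain ⟨ξ₁, h₁, ξ₂, h₂, rfl⟩ := Submodule.mem_sup.1 hξ
  rw [map_add, LinearMap.add_apply]
  exact S.add_mem (hSP m hm _ h₁ h hhP) (hSQ n hn _ h₂ h hhQ)

/-- If `P` and `Q` are in general position except possibly at the index `t`, then `S` contains
all rank-one maps with image spanned by the class of a vector of `P t`. -/
lemma ContainsRaising.quotRankOne_mem_of_mem [FiniteDimensional k H] {d : ℕ}
    (hH : finrank k H = d) {P Q : ℕ → Submodule k H} (hP : IsCompleteFlag k d P)
    (hQ : IsCompleteFlag k d Q) {t : ℕ} (hbot : ∀ i ≤ d, i ≠ t → P i ⊓ Q (d - i) = ⊥)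
    {Λ : Submodule k H} {S : Submodule k (↥Λ →ₗ[k] H ⧸ Λ)}
    (hSP : ContainsRaising d P Λ S) (hSQ : ContainsRaising d Q Λ S) (ξ : Dual k H)
    {m : ℕ} (htm : t ≤ m) (hmd : m ≤ d) {h : H} (hh : h ∈ P m) : quotRankOne Λ ξ h ∈ S := by
  induction hmd using Nat.decreasingInduction generalizing h with
  | self =>
    rw [hP.eq_bot, Submodule.mem_bot] at hh
    rw [hh, map_zero]
    exact S.zero_mem
  | of_succ m hmd ih =>
    have hbot' := hbot (m + 1) hmd (by omega)
    have hle : P (m + 1) ⊔ P m ⊓ Q (d - (m + 1)) ≤ P m := sup_le (hP.2 m hmd) inf_le_left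
    have hinf : P (m + 1) ⊓ (P m ⊓ Q (d - (m + 1))) = ⊥ :=
      le_bot_iff.1 ((inf_le_inf_left _ inf_le_right).trans hbot'.le)
    have heq : P (m + 1) ⊔ P m ⊓ Q (d - (m + 1)) = P m := by
      apply Submodule.eq_of_le_of_finrank_le hle
      have h1 := Submodule.finrank_sup_add_finrank_inf_eq (P (m + 1)) (P m ⊓ Q (d - (m + 1)))
      have h2 := Submodule.finrank_sup_add_finrank_inf_eq (P m) (Q (d - (m + 1)))
      have h3 := Submodule.finrank_le (P m ⊔ Q (d - (m + 1)))
      have h4 := hP.1 m (by omega)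
      have h5 := hP.1 (m + 1) (by omega)
      have h6 := hQ.1 (d - (m + 1)) (by omega)
      rw [hinf, finrank_bot] at h1
      omega
    rw [← heq] at hh
    obtain ⟨x, hx, y, hy, rfl⟩ := Submodule.mem_sup.1 hh
    rw [map_add]
    refine S.add_mem (ih (by omega) hx) (hSP.quotRankOne_mem hSQ hmd
      (n := d - (m + 1)) (by omega) hy.1 hy.2 ?_)
    have hz : P (m + 1) ⊓ Q (d - (m + 1) + 1) = ⊥ :=
      le_bot_iff.1 ((inf_le_inf_left _ (hQ.2 _ (by omega))).trans hbot'.le)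
    rw [hz, Submodule.dualAnnihilator_bot]
    exact Submodule.mem_top

/-- For almost-transverse flags with special index `t`, a vector of `P (t - 1) ⊓ Q (d - t - 1)`
spans a complement of the hyperplane `P t ⊔ Q (d - t)`. -/
lemma exists_sup_span_singleton_eq_top [FiniteDimensional k H] {d : ℕ} (hH : finrank k H = d)
    {P Q : ℕ → Submodule k H} (hP : IsCompleteFlag k d P) (hQ : IsCompleteFlag k d Q)
    {t : ℕ} (ht1 : 1 ≤ t) (ht2 : t < d)
    (hbot : ∀ i ≤ d, i ≠ t → P i ⊓ Q (d - i) = ⊥) :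
    ∃ e ∈ P (t - 1) ⊓ Q (d - t - 1), P t ⊔ Q (d - t) ⊔ span k {e} = ⊤ := by
  have p0 := hP.1 (t - 1) (by omega)
  have p1 := hP.1 t (by omega)
  have p2 := hP.1 (t + 1) (by omega)
  have q0 := hQ.1 (d - t - 1) (by omega)
  have q1 := hQ.1 (d - t) (by omega)
  have hPt : P t ≤ P (t - 1) := hP.antitone (by omega) (by omega)
  have hnle : ¬ P (t - 1) ⊓ Q (d - t - 1) ≤ P t := fun hle => by
    have h1 := Submodule.finrank_sup_add_finrank_inf_eq (P (t - 1)) (Q (d - t - 1))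
    have h2 := Submodule.finrank_le (P (t - 1) ⊔ Q (d - t - 1))
    have h3 := Submodule.finrank_sup_add_finrank_inf_eq (P (t + 1)) (P (t - 1) ⊓ Q (d - t - 1))
    have h4 : P (t + 1) ⊔ P (t - 1) ⊓ Q (d - t - 1) ≤ P t := sup_le (hP.2 t ht2) hle
    have h5 : P (t + 1) ⊓ (P (t - 1) ⊓ Q (d - t - 1)) = ⊥ :=
      le_bot_iff.1 ((inf_le_inf_left _ inf_le_right).trans (hbot (t + 1) ht2 (by omega)).le)
    have h6 := Submodule.finrank_mono h4
    rw [h5, finrank_bot] at h3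
    omega
  obtain ⟨e, he, het⟩ := SetLike.not_le_iff_exists.1 hnle
  refine ⟨e, he, ?_⟩
  have hsup : P t ⊔ span k {e} = P (t - 1) := by
    apply Submodule.eq_of_le_of_finrank_le
    · exact sup_le hPt ((Submodule.span_singleton_le_iff_mem _ _).2 he.1)
    · have hlt : P t < P t ⊔ span k {e} := by
        refine lt_of_le_of_ne le_sup_left fun h => het ?_
        rw [h]
        exact Submodule.mem_sup_right (Submodule.mem_span_singleton_self e)
      have := Submodule.finrank_lt_finrank_of_lt hlt
      omega
  rw [sup_right_comm, hsup]
  have hinf : P (t - 1) ⊓ Q (d - (t - 1)) = ⊥ := hbot (t - 1) (by omega) (by omega)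
  have hle1 : finrank k ↥(P (t - 1) ⊓ Q (d - t)) ≤ 1 := by
    have h1 := Submodule.finrank_sup_add_finrank_inf_eq (Q (d - (t - 1))) (P (t - 1) ⊓ Q (d - t))
    have h2 : Q (d - (t - 1)) ⊔ P (t - 1) ⊓ Q (d - t) ≤ Q (d - t) :=
      sup_le (hQ.antitone (by omega) (by omega)) inf_le_right
    have h3 : Q (d - (t - 1)) ⊓ (P (t - 1) ⊓ Q (d - t)) = ⊥ := by
      rw [← le_bot_iff, ← hinf, inf_comm (P (t - 1)) (Q (d - (t - 1)))]
      exact inf_le_inf_left _ inf_le_left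
    have h4 := Submodule.finrank_mono h2
    have h5 := hQ.1 (d - (t - 1)) (by omega)
    rw [h3, finrank_bot] at h1
    omega
  apply Submodule.eq_top_of_finrank_eq
  have h1 := Submodule.finrank_sup_add_finrank_inf_eq (P (t - 1)) (Q (d - t))
  have h2 := Submodule.finrank_le (P (t - 1) ⊔ Q (d - t))
  omega

end RankOneMaps

section AlmostTransverse

variable {k : Type*} [Field k] {H : Type*} [AddCommGroup H] [Module k H]

/-- If `t` is not an active value of `a`, then the rank-one maps raising the index of `P` from
`t - 1` to `t + 1` lie in `schubertTangent`. -/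
lemma quotRankOne_mem_schubertTangent_of_not_active {d r : ℕ} {P : ℕ → Submodule k H}
    (hP : IsCompleteFlag k d P) {a : ℕ → ℕ} (ha : ∀ i < r, a i < a (i + 1)) (had : a r < d)
    {Λ : Submodule k H} {t : ℕ} (ht : t < d)
    (hact : ¬ ∃ i ≤ r, ActiveIdx a i ∧ a i = t) {ξ : Dual k H}
    (hξ : ξ ∈ (P (t + 1)).dualAnnihilator) {h : H} (hh : h ∈ P (t - 1)) :
    quotRankOne Λ ξ h ∈ schubertTangent k P a Λ {i | i ≤ r ∧ ActiveIdx a i} := by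
  refine quotRankOne_mem_schubertTangent hP (by omega) (fun i hi => ?_)
    (fun i hi => (le_of_strictMono_below ha hi.1 le_rfl).trans had.le) hξ hh
  have : a i ≠ t := fun h => hact ⟨i, hi.1, hi.2, h⟩
  omega

lemma exists_mem_dualAnnihilator_apply_ne_zero {W : Submodule k H} {v : H} (hv : v ∉ W) :
    ∃ ξ ∈ W.dualAnnihilator, ξ v ≠ 0 := by
  obtain ⟨ξ, hξv, hξW⟩ := Submodule.exists_le_ker_of_notMem hv
  exact ⟨ξ, (Submodule.mem_dualAnnihilator ξ).2 fun w hw => hξW hw, hξv⟩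

/-- A space `S` of maps `Λ → H ⧸ Λ` containing the rank-one maps `ξ ⊗ [h]` with `h` in a
hyperplane `K` or with `ξ v = 0` is everything, up to one rank-one map. -/
lemma sup_span_quotRankOne_eq_top [FiniteDimensional k H] {Λ K : Submodule k H}
    {S : Submodule k (↥Λ →ₗ[k] H ⧸ Λ)} {e v : H} (hKe : K ⊔ span k {e} = ⊤)
    (hSK : ∀ ξ, ∀ h ∈ K, quotRankOne Λ ξ h ∈ S)
    (hSe : ∀ ξ : Dual k H, ξ v = 0 → quotRankOne Λ ξ e ∈ S) {ξ₀ : Dual k H} (hξ₀ : ξ₀ v ≠ 0) :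
    S ⊔ span k {quotRankOne Λ ξ₀ e} = ⊤ := by
  refine eq_top_of_quotRankOne_mem fun ξ h => ?_
  have hh : h ∈ K ⊔ span k {e} := hKe ▸ Submodule.mem_top
  obtain ⟨x, hx, y, hy, rfl⟩ := Submodule.mem_sup.1 hh
  obtain ⟨c, rfl⟩ := Submodule.mem_span_singleton.1 hy
  have hξ : ξ = (ξ - (ξ v / ξ₀ v) • ξ₀) + (ξ v / ξ₀ v) • ξ₀ := (sub_add_cancel _ _).symm
  have hmem : quotRankOne Λ ξ e ∈ S ⊔ span k {quotRankOne Λ ξ₀ e} := by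
    rw [hξ, map_add, LinearMap.add_apply, map_smul, LinearMap.smul_apply]
    refine Submodule.add_mem_sup (hSe _ ?_)
      (Submodule.smul_mem _ _ (Submodule.mem_span_singleton_self _))
    simp [div_mul_cancel₀ _ hξ₀]
  rw [map_add, map_smul]
  exact Submodule.add_mem _ (Submodule.mem_sup_left (hSK ξ x hx)) (Submodule.smul_mem _ c hmem)

/-- The condition that `t` and `d - t` are active values and `Λ` lies between
`P t ⊓ Q (d - t)` and `P t ⊔ Q (d - t)`. -/
def IsSpecialPosition (d r t : ℕ) (P Q : ℕ → Submodule k H) (a b : ℕ → ℕ)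
    (Λ : Submodule k H) : Prop :=
  (∃ i ≤ r, ActiveIdx a i ∧ a i = t) ∧ (∃ i' ≤ r, ActiveIdx b i' ∧ b i' = d - t) ∧
    P t ⊓ Q (d - t) ≤ Λ ∧ Λ ≤ P t ⊔ Q (d - t)

/-- For almost-transverse flags, the sum of the two Schubert tangent spaces is a hyperplane in
the special position, and everything otherwise. -/
lemma schubertTangent_sup_schubertTangent [FiniteDimensional k H] {d : ℕ}
    (hH : finrank k H = d) {P Q : ℕ → Submodule k H} (hP : IsCompleteFlag k d P)
    (hQ : IsCompleteFlag k d Q) {t : ℕ} (ht1 : 1 ≤ t) (ht2 : t < d)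
    (htdim : finrank k ↥(P t ⊓ Q (d - t)) = 1)
    (hbot : ∀ i ≤ d, i ≠ t → P i ⊓ Q (d - i) = ⊥) {r : ℕ} {a b : ℕ → ℕ}
    (ha : ∀ i < r, a i < a (i + 1)) (had : a r < d)
    (hb : ∀ i < r, b i < b (i + 1)) (hbd : b r < d) {Λ : Submodule k H}
    {S : Submodule k (↥Λ →ₗ[k] H ⧸ Λ)}
    (hS : S = schubertTangent k P a Λ {i | i ≤ r ∧ ActiveIdx a i} ⊔
      schubertTangent k Q b Λ {i | i ≤ r ∧ ActiveIdx b i}) :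
    (IsSpecialPosition d r t P Q a b Λ → finrank k S + 1 = finrank k (↥Λ →ₗ[k] H ⧸ Λ)) ∧
    (¬ IsSpecialPosition d r t P Q a b Λ → S = ⊤) := by
  have hPS : schubertTangent k P a Λ {i | i ≤ r ∧ ActiveIdx a i} ≤ S := hS ▸ le_sup_left
  have hQS : schubertTangent k Q b Λ {i | i ≤ r ∧ ActiveIdx b i} ≤ S := hS ▸ le_sup_right
  have hSP := containsRaising_of_schubertTangent_le hP ha had hPS
  have hSQ := containsRaising_of_schubertTangent_le hQ hb hbd hQS
  have hbot' : ∀ i ≤ d, i ≠ d - t → Q i ⊓ P (d - i) = ⊥ := fun i hi hit => by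
    have := hbot (d - i) (by omega) (by omega)
    rwa [Nat.sub_sub_self hi, inf_comm] at this
  obtain ⟨e, he, hKe⟩ := exists_sup_span_singleton_eq_top hH hP hQ ht1 ht2 hbot
  obtain ⟨⟨v, hvP, hvQ⟩, hv0, hv⟩ := finrank_eq_one_iff'.1 htdim
  have hv0' : v ≠ 0 := fun h => hv0 (Subtype.ext h)
  have hspan : P t ⊓ Q (d - t) = span k {v} := by
    apply le_antisymm
    · intro w hw
      obtain ⟨c, hc⟩ := hv ⟨w, hw⟩
      exact Submodule.mem_span_singleton.2 ⟨c, congrArg Subtype.val hc⟩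
    · exact (Submodule.span_singleton_le_iff_mem _ _).2 ⟨hvP, hvQ⟩
  have hSK : ∀ ξ, ∀ h ∈ P t ⊔ Q (d - t), quotRankOne Λ ξ h ∈ S := fun ξ h hh => by
    obtain ⟨x, hx, y, hy, rfl⟩ := Submodule.mem_sup.1 hh
    rw [map_add]
    exact S.add_mem
      (ContainsRaising.quotRankOne_mem_of_mem hH hP hQ hbot hSP hSQ ξ le_rfl ht2.le hx)
      (ContainsRaising.quotRankOne_mem_of_mem hH hQ hP hbot' hSQ hSP ξ le_rfl (by omega) hy)
  have hSe : ∀ ξ : Dual k H, ξ v = 0 → quotRankOne Λ ξ e ∈ S := fun ξ hξ => by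
    refine hSP.quotRankOne_mem hSQ (m := t - 1) (n := d - t - 1) (by omega) (by omega)
      he.1 he.2 ?_
    rw [Nat.sub_add_cancel ht1, Nat.sub_add_cancel (show 1 ≤ d - t by omega), hspan,
      Submodule.mem_dualAnnihilator]
    intro w hw
    obtain ⟨c, rfl⟩ := Submodule.mem_span_singleton.1 hw
    rw [map_smul, hξ, smul_zero]
  have hKdim : finrank k ↥(P t ⊔ Q (d - t)) + 1 = d := by
    have h1 := Submodule.finrank_sup_add_finrank_inf_eq (P t) (Q (d - t))
    have h2 := hP.1 t ht2.le
    have h3 := hQ.1 (d - t) (by omega)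
    omega
  constructor
  · rintro ⟨⟨i, hir, hi, hit⟩, ⟨j, hjr, hj, hjt⟩, hinf, hsup⟩
    have hvΛ : v ∈ Λ := hinf ⟨hvP, hvQ⟩
    have hvn : v ∉ (⊥ : Submodule k H) := hv0'
    obtain ⟨ξ, -, hξv⟩ := exists_mem_dualAnnihilator_apply_ne_zero hvn
    have htop := sup_span_quotRankOne_eq_top hKe hSK hSe hξv
    have hle : S ≤ ((P t ⊔ Q (d - t)).map Λ.mkQ).comap (LinearMap.applyₗ ⟨v, hvΛ⟩) := by
      rw [hS]
      refine sup_le (fun φ hφ => ?_) (fun φ hφ => ?_)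
      · have := mem_schubertTangent.1 hφ i ⟨hir, hi⟩ ⟨v, hvΛ⟩ (by rwa [hit])
        rw [hit] at this
        exact Submodule.map_mono le_sup_left this
      · have := mem_schubertTangent.1 hφ j ⟨hjr, hj⟩ ⟨v, hvΛ⟩ (by rwa [hjt])
        rw [hjt] at this
        exact Submodule.map_mono le_sup_right this
    have heK : e ∉ P t ⊔ Q (d - t) := fun h => by
      rw [sup_eq_left.2 ((Submodule.span_singleton_le_iff_mem _ _).2 h)] at hKe
      rw [hKe, finrank_top] at hKdim
      omega
    have hne : S ≠ ⊤ := fun h => heK <| by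
      have h1 : quotRankOne Λ ξ e ∈ S := h ▸ Submodule.mem_top
      have h2 : ξ v • Λ.mkQ e ∈ (P t ⊔ Q (d - t)).map Λ.mkQ := hle h1
      obtain ⟨x, hx, hxe⟩ := (Submodule.smul_mem_iff _ hξv).1 h2
      have h3 : e - x ∈ Λ := (Submodule.Quotient.eq Λ).1 hxe.symm
      have := Submodule.add_mem _ (hsup h3) hx
      rwa [sub_add_cancel] at this
    have h1 := Submodule.finrank_lt hne
    have h2 := Submodule.finrank_add_le_finrank_add_finrank S (span k {quotRankOne Λ ξ e})
    have h3 := finrank_span_le_card (R := k) {quotRankOne Λ ξ e}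
    rw [htop, finrank_top] at h2
    rw [Set.toFinset_singleton, Finset.card_singleton] at h3
    omega
  · intro hns
    suffices ∃ ξ : Dual k H, ξ v ≠ 0 ∧ quotRankOne Λ ξ e ∈ S by
      obtain ⟨ξ, hξ, hmem⟩ := this
      rw [← sup_span_quotRankOne_eq_top hKe hSK hSe hξ, left_eq_sup]
      exact (Submodule.span_singleton_le_iff_mem _ _).2 hmem
    by_cases h1 : ∃ i ≤ r, ActiveIdx a i ∧ a i = t
    swap
    · have hvn : v ∉ P (t + 1) := fun h => hv0' <| by
        rw [← Submodule.mem_bot k, ← hbot (t + 1) ht2 (by omega)]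
        exact ⟨h, hQ.antitone (by omega) (by omega) hvQ⟩
      obtain ⟨ξ, hξ, hξv⟩ := exists_mem_dualAnnihilator_apply_ne_zero hvn
      exact ⟨ξ, hξv, hPS <|
        quotRankOne_mem_schubertTangent_of_not_active hP ha had ht2 h1 hξ he.1⟩
    by_cases h2 : ∃ i ≤ r, ActiveIdx b i ∧ b i = d - t
    swap
    · have hvn : v ∉ Q (d - t + 1) := fun h => hv0' <| by
        rw [← Submodule.mem_bot k, ← hbot' (d - t + 1) (by omega) (by omega)]
        exact ⟨h, hP.antitone (by omega) (by omega) hvP⟩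
      obtain ⟨ξ, hξ, hξv⟩ := exists_mem_dualAnnihilator_apply_ne_zero hvn
      exact ⟨ξ, hξv, hQS <|
        quotRankOne_mem_schubertTangent_of_not_active hQ hb hbd (by omega) h2 hξ he.2⟩
    by_cases h3 : v ∈ Λ
    swap
    · obtain ⟨ξ, hξ, hξv⟩ := exists_mem_dualAnnihilator_apply_ne_zero h3
      refine ⟨ξ, hξv, ?_⟩
      rw [quotRankOne_eq_zero_of_le_ker ((Submodule.mem_dualAnnihilator ξ).1 hξ) e]
      exact S.zero_mem
    have h4 : ¬ Λ ≤ P t ⊔ Q (d - t) := fun h => hns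
      ⟨h1, h2, hspan ▸ (Submodule.span_singleton_le_iff_mem _ _).2 h3, h⟩
    have htop : P t ⊔ Q (d - t) ⊔ Λ = ⊤ := by
      apply Submodule.eq_top_of_finrank_eq
      have h5 := Submodule.finrank_lt_finrank_of_lt (left_lt_sup.2 h4)
      have h6 := Submodule.finrank_le (P t ⊔ Q (d - t) ⊔ Λ)
      omega
    have hemem : e ∈ P t ⊔ Q (d - t) ⊔ Λ := htop ▸ Submodule.mem_top
    obtain ⟨x, hx, y, hy, rfl⟩ := Submodule.mem_sup.1 hemem
    have hvn : v ∉ (⊥ : Submodule k H) := hv0'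
    obtain ⟨ξ, -, hξv⟩ := exists_mem_dualAnnihilator_apply_ne_zero hvn
    refine ⟨ξ, hξv, ?_⟩
    rw [map_add, quotRankOne_eq_zero_of_mem ξ hy, add_zero]
    exact hSK ξ x hx

end AlmostTransverse

/-- Corollary 2.13 of the paper: for almost-transverse flags with special
index `t` (and `t' = d - t`) and `Λ ∈ Σ°_{P,a} ∩ Σ°_{Q,b}`: if `t = a_i` for some active
`i`, `t' = b_{i'}` for some active `i'`, and `P^t ∩ Q^{t'} ⊆ Λ ⊆ P^t + Q^{t'}`, then
`dim T(Λ) = E + 1`; otherwise `dim T(Λ) = E`. -/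
theorem pairTangent_dim_almostTransverse (k H : Type*) [Field k] [IsAlgClosed k]
    [AddCommGroup H] [Module k H] (d : ℕ) (hd : 1 ≤ d)
    (hH : Module.finrank k H = d) (P Q : ℕ → Submodule k H)
    (hP : IsCompleteFlag k d P) (hQ : IsCompleteFlag k d Q)
    (t : ℕ) (ht1 : 1 ≤ t) (ht2 : t < d)
    (htdim : Module.finrank k ↥(P t ⊓ Q (d - t)) = 1)
    (ht0 : ∀ i, 1 ≤ i → i < d → i ≠ t → Module.finrank k ↥(P i ⊓ Q (d - i)) = 0)
    (r : ℕ) (a b : ℕ → ℕ)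
    (ha : ∀ i < r, a i < a (i + 1)) (had : a r < d)
    (hb : ∀ i < r, b i < b (i + 1)) (hbd : b r < d)
    (Λ : Submodule k H) (hΛ : Module.finrank k ↥Λ = r + 1)
    (hΛa : MemSchubertOpen k r P a Λ) (hΛb : MemSchubertOpen k r Q b Λ) :
    (((∃ i ≤ r, ActiveIdx a i ∧ a i = t) ∧ (∃ i' ≤ r, ActiveIdx b i' ∧ b i' = d - t) ∧
        P t ⊓ Q (d - t) ≤ Λ ∧ Λ ≤ P t ⊔ Q (d - t)) →
      (Module.finrank k ↥(pairTangent k r P Q a b Λ) : ℤ) =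
        (((r : ℤ) + 1) * ((d : ℤ) - (r : ℤ) - 1) -
          (∑ i ∈ Finset.range (r + 1), ((a i : ℤ) - (i : ℤ))) -
          (∑ i ∈ Finset.range (r + 1), ((b i : ℤ) - (i : ℤ)))) + 1) ∧
    (¬((∃ i ≤ r, ActiveIdx a i ∧ a i = t) ∧ (∃ i' ≤ r, ActiveIdx b i' ∧ b i' = d - t) ∧
        P t ⊓ Q (d - t) ≤ Λ ∧ Λ ≤ P t ⊔ Q (d - t)) →
      (Module.finrank k ↥(pairTangent k r P Q a b Λ) : ℤ) =
        ((r : ℤ) + 1) * ((d : ℤ) - (r : ℤ) - 1) -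
          (∑ i ∈ Finset.range (r + 1), ((a i : ℤ) - (i : ℤ))) -
          (∑ i ∈ Finset.range (r + 1), ((b i : ℤ) - (i : ℤ)))) := by
  have hfin : FiniteDimensional k H := Module.finite_of_finrank_pos (by omega)
  have hbot : ∀ i ≤ d, i ≠ t → P i ⊓ Q (d - i) = ⊥ := fun i hid hit => by
    rcases Nat.eq_zero_or_pos i with rfl | hi
    · rw [Nat.sub_zero, hQ.eq_bot, inf_bot_eq]
    · rcases hid.eq_or_lt with rfl | hlt
      · rw [hP.eq_bot, bot_inf_eq]
      · exact Submodule.finrank_eq_zero.1 (ht0 i hi hlt hit)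
  obtain ⟨hspecial, hgeneral⟩ := schubertTangent_sup_schubertTangent hH hP hQ ht1 ht2 htdim hbot
    ha had hb hbd (Λ := Λ) rfl
  have hdimP := finrank_schubertTangent hH hP ha had hΛ hΛa
  have hdimQ := finrank_schubertTangent hH hQ hb hbd hΛ hΛb
  have hadd := Submodule.finrank_sup_add_finrank_inf_eq
    (schubertTangent k P a Λ {i | i ≤ r ∧ ActiveIdx a i})
    (schubertTangent k Q b Λ {i | i ≤ r ∧ ActiveIdx b i})
  have hW : (finrank k (↥Λ →ₗ[k] H ⧸ Λ) : ℤ) = ((r : ℤ) + 1) * ((d : ℤ) - r - 1) := by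
    have h1 := Submodule.finrank_quotient_add_finrank Λ
    have h2 : (finrank k (H ⧸ Λ) : ℤ) = (d : ℤ) - r - 1 := by omega
    rw [Module.finrank_linearMap, hΛ, Nat.cast_mul, h2]
    push_cast
    ring
  rw [← hW]
  unfold pairTangent
  refine ⟨fun h => ?_, fun h => ?_⟩
  · have := hspecial h
    omega
  · rw [hgeneral h, finrank_top] at hadd
    omega
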